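/- Let δ > 0 and δ_k = δ/2^k. For each k let v_k : ℕ_0^n → [0,∞) satisfy v_k(m+e_i) − v_k(m) ≥ a_i p_i δ_k for every i and v_k(m+1) − v_k(m) ≤ v_k(m)(e^{(c+λ)δ_k} − 1) for every m, and let V_k(x) := v_k(ρ^{δ_k}(x)) + a·(x − ⟨x⟩^{δ_k}). Assume: (i) V_k ≤ V_{k+1} pointwise and V̄(x) := lim_k V_k(x) is finite for every x ∈ ℝ_+^n; (ii) v_k(m) ≥ f(g^{δ_k}(m)) for every k and m; (iii) for every k and every m ∈ ℕ_0^n, writing x = g^{δ_k}(m), one has V_k(x) ≥ e^{−(c+λ)δ_k} V_k(x + δ_k p) + ∫_0^{δ_k} λ e^{−(c+λ)t} ( ∫_{{α : α ≤ x+tp}} V_k(x+tp−α) dF(α) ) dt − ∫_0^{δ_k} e^{−(c+λ)t} R(x+tp) dt. Then V̄ is a viscosity supersolution of the HJB equation at every point of the interior of ℝ_+^n. -/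

import Mathlib

open MeasureTheory Filter

noncomputable section

/-- The grid point associated with a multi-index `m`: `g^δ(m) = (p₁ δ m₁, …, pₙ δ mₙ)`. -/
def gdel (n : ℕ) (p : Fin n → ℝ) (δ : ℝ) (m : Fin n → ℕ) : Fin n → ℝ :=
  fun i => p i * δ * (m i : ℝ)

/-- The index of the closest grid point below `x`: `ρ^δ(x) = (⌊xᵢ/(δ pᵢ)⌋)ᵢ`. -/
def rho (n : ℕ) (p : Fin n → ℝ) (δ : ℝ) (x : Fin n → ℝ) : Fin n → ℕ :=
  fun i => ⌊x i / (δ * p i)⌋₊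

/-- The closest grid point below `x`: `⟨x⟩^δ = g^δ(ρ^δ(x))`. -/
def proj (n : ℕ) (p : Fin n → ℝ) (δ : ℝ) (x : Fin n → ℝ) : Fin n → ℝ :=
  gdel n p δ (rho n p δ x)

/-- The extension `V(x) = v(ρ^δ(x)) + a·(x − ⟨x⟩^δ)` of a grid function `v`. -/
def Vext (n : ℕ) (p a : Fin n → ℝ) (δ : ℝ) (v : (Fin n → ℕ) → ℝ) (x : Fin n → ℝ) : ℝ :=
  v (rho n p δ x) + ∑ i, a i * (x i - proj n p δ x i)

/-- `R(x) = λ ∫_{x - α ∉ ℝ₊ⁿ} υ(x,α) dF(α)`. -/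
def Rpen (n : ℕ) (lam : ℝ) (F : Measure (Fin n → ℝ))
    (υ : (Fin n → ℝ) → (Fin n → ℝ) → ℝ) (x : Fin n → ℝ) : ℝ :=
  lam * ∫ α in {α : Fin n → ℝ | ¬ 0 ≤ x - α}, υ x α ∂F

/-- The integral operator `I(W)(x) = λ ∫_{x-α ∈ ℝ₊ⁿ} W(x−α) dF(α)`. -/
def Iop (n : ℕ) (lam : ℝ) (F : Measure (Fin n → ℝ))
    (W : (Fin n → ℝ) → ℝ) (x : Fin n → ℝ) : ℝ :=
  lam * ∫ α in {α : Fin n → ℝ | 0 ≤ x - α}, W (x - α) ∂F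

/-- The discounted generator `L(W)(x) = p·∇W(x) − (c+λ)W(x) + I(W)(x) − R(x)`. -/
def Lop (n : ℕ) (p : Fin n → ℝ) (lam c : ℝ) (F : Measure (Fin n → ℝ))
    (υ : (Fin n → ℝ) → (Fin n → ℝ) → ℝ) (W : (Fin n → ℝ) → ℝ) (x : Fin n → ℝ) : ℝ :=
  (∑ i, p i * fderiv ℝ W x (Pi.single i 1)) - (c + lam) * W x +
    Iop n lam F W x - Rpen n lam F υ x


lemma aux_step_mono (n : ℕ) (w : (Fin n → ℕ) → ℝ)
    (h : ∀ m i, w m ≤ w (m + Pi.single i 1)) : Monotone w := by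
  have key : ∀ N : ℕ, ∀ m d : Fin n → ℕ, ∑ i, d i = N → w m ≤ w (m + d) := by
    intro N
    induction N with
    | zero =>
      intro m d hd
      have : d = 0 := by
        funext i
        exact (Finset.sum_eq_zero_iff.mp hd) i (Finset.mem_univ i)
      simp [this]
    | succ N ih =>
      intro m d hd
      have hex : ∃ i, 0 < d i := by
        by_contra hcon
        push Not at hcon
        have : ∑ i, d i = 0 := Finset.sum_eq_zero (fun i _ => Nat.le_zero.mp (hcon i))
        omega
      obtain ⟨i, hi⟩ := hex
      have hle : Pi.single i 1 ≤ d := by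
        intro j
        by_cases hj : j = i
        · subst hj; simpa using Nat.succ_le_of_lt hi
        · simp [hj]
      obtain ⟨d', hd'⟩ := exists_add_of_le hle
      have hs : ∑ j, d' j = N := by
        rw [hd'] at hd
        simp only [Pi.add_apply, Finset.sum_add_distrib, Finset.sum_pi_single', Finset.mem_univ,
          if_true] at hd
        have : ∑ j, (Pi.single i 1 : Fin n → ℕ) j = 1 := by simp
        omega
      calc w m ≤ w (m + Pi.single i 1) := h m i
        _ ≤ w (m + Pi.single i 1 + d') := ih _ _ hs
        _ = w (m + d) := by rw [hd', add_assoc]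
  intro m m' hm
  obtain ⟨d, rfl⟩ := exists_add_of_le hm
  exact key _ m d rfl

lemma aux_rho_mono (n : ℕ) (p : Fin n → ℝ) (d : ℝ) (hp : ∀ i, 0 < p i) (hd : 0 < d) :
    Monotone (rho n p d) := by
  intro x y hxy i
  have : 0 < d * p i := mul_pos hd (hp i)
  exact Nat.floor_mono (div_le_div_of_nonneg_right (hxy i) this.le)

lemma aux_rho_gdel (n : ℕ) (p : Fin n → ℝ) (d : ℝ) (hp : ∀ i, 0 < p i) (hd : 0 < d)
    (m : Fin n → ℕ) : rho n p d (gdel n p d m) = m := by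
  funext i
  have h := (hp i).ne'
  have : p i * d * (m i : ℝ) / (d * p i) = m i := by field_simp
  simp [rho, gdel, this]

lemma aux_Vext_gdel (n : ℕ) (p a : Fin n → ℝ) (d : ℝ) (hp : ∀ i, 0 < p i) (hd : 0 < d)
    (v : (Fin n → ℕ) → ℝ) (m : Fin n → ℕ) : Vext n p a d v (gdel n p d m) = v m := by
  simp [Vext, proj, aux_rho_gdel n p d hp hd]

lemma aux_gdel_succ (n : ℕ) (p : Fin n → ℝ) (d : ℝ) (m : Fin n → ℕ) :
    gdel n p d (m + 1) = gdel n p d m + d • p := by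
  funext i
  simp [gdel]; ring

lemma aux_Vext_lin (n : ℕ) (p a : Fin n → ℝ) (d : ℝ) (hp : ∀ i, 0 < p i) (hd : 0 < d)
    (v : (Fin n → ℕ) → ℝ)
    (hv1 : ∀ (m : Fin n → ℕ) (i : Fin n), a i * p i * d ≤ v (m + Pi.single i 1) - v m)
    (x y : Fin n → ℝ) (hxy : x ≤ y) :
    Vext n p a d v x + ∑ i, a i * (y i - x i) ≤ Vext n p a d v y := by
  have hmon := aux_step_mono n (fun m => v m - ∑ i, a i * (p i * d * (m i : ℝ))) (by
    intro m i
    have h1 := hv1 m i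
    have h2 : ∑ j, a j * (p j * d * (((m + Pi.single i 1 : Fin n → ℕ) j : ℕ) : ℝ))
        = ∑ j, a j * (p j * d * (m j : ℝ)) + a i * p i * d := by
      have : ∀ j, a j * (p j * d * (((m + Pi.single i 1 : Fin n → ℕ) j : ℕ) : ℝ))
          = a j * (p j * d * (m j : ℝ)) + if j = i then a i * p i * d else 0 := by
        intro j
        by_cases hj : j = i
        · subst hj; simp; ring
        · simp [hj]
      simp_rw [this, Finset.sum_add_distrib]
      simp
    simp only [h2]
    linarith)
  have h := hmon (aux_rho_mono n p d hp hd hxy)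
  simp only [Vext, proj, gdel, mul_sub, Finset.sum_sub_distrib] at h ⊢
  linarith

lemma aux_Vext_mono (n : ℕ) (p a : Fin n → ℝ) (d : ℝ) (hp : ∀ i, 0 < p i) (hd : 0 < d)
    (ha : ∀ i, 0 < a i) (v : (Fin n → ℕ) → ℝ)
    (hv1 : ∀ (m : Fin n → ℕ) (i : Fin n), a i * p i * d ≤ v (m + Pi.single i 1) - v m) :
    Monotone (Vext n p a d v) := by
  intro x y hxy
  have h := aux_Vext_lin n p a d hp hd v hv1 x y hxy
  have : 0 ≤ ∑ i, a i * (y i - x i) :=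
    Finset.sum_nonneg fun i _ => mul_nonneg (ha i).le (sub_nonneg.mpr (hxy i))
  linarith

lemma aux_proj_le (n : ℕ) (p : Fin n → ℝ) (d : ℝ) (hp : ∀ i, 0 < p i) (hd : 0 < d)
    (x : Fin n → ℝ) (hx : 0 ≤ x) : proj n p d x ≤ x := by
  intro i
  have hpos : 0 < d * p i := mul_pos hd (hp i)
  have := Nat.floor_le (div_nonneg (hx i) hpos.le)
  rw [le_div_iff₀ hpos] at this
  simp only [proj, gdel, rho]
  linarith

lemma aux_lt_proj (n : ℕ) (p : Fin n → ℝ) (d : ℝ) (hp : ∀ i, 0 < p i) (hd : 0 < d)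
    (x : Fin n → ℝ) : x ≤ gdel n p d (rho n p d x + 1) := by
  intro i
  have hpos : 0 < d * p i := mul_pos hd (hp i)
  have := (Nat.lt_floor_add_one (x i / (d * p i))).le
  rw [div_le_iff₀ hpos] at this
  simp only [gdel, rho, Pi.add_apply, Pi.one_apply]
  push_cast
  linarith

lemma aux_le_Vext (n : ℕ) (p a : Fin n → ℝ) (d : ℝ) (hp : ∀ i, 0 < p i) (hd : 0 < d)
    (ha : ∀ i, 0 < a i) (v : (Fin n → ℕ) → ℝ) (x : Fin n → ℝ) (hx : 0 ≤ x) :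
    v (rho n p d x) ≤ Vext n p a d v x := by
  have : 0 ≤ ∑ i, a i * (x i - proj n p d x i) :=
    Finset.sum_nonneg fun i _ => mul_nonneg (ha i).le
      (sub_nonneg.mpr (aux_proj_le n p d hp hd x hx i))
  simp only [Vext]
  linarith

lemma aux_Vext_meas (n : ℕ) (p a : Fin n → ℝ) (d : ℝ) (v : (Fin n → ℕ) → ℝ) :
    Measurable (Vext n p a d v) := by
  have hr : Measurable (rho n p d) := by
    apply measurable_pi_lambda
    intro i
    exact Nat.measurable_floor.comp ((measurable_pi_apply i).div_const _)
  have hg : Measurable (gdel n p d) := Measurable.of_discrete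
  have hv : Measurable v := Measurable.of_discrete
  unfold Vext
  refine (hv.comp hr).add (Finset.measurable_fun_sum _ fun i _ => ?_)
  exact measurable_const.mul ((measurable_pi_apply i).sub
    ((measurable_pi_apply i).comp (hg.comp hr)))

lemma aux_int (n : ℕ) (F : Measure (Fin n → ℝ)) [IsProbabilityMeasure F]
    (hFpos : F {α | ¬ 0 ≤ α} = 0) (V : (Fin n → ℝ) → ℝ) (hV : Measurable V)
    (hm : Monotone V) (h0 : ∀ x, 0 ≤ x → 0 ≤ V x) (z x : Fin n → ℝ) (hzx : x ≤ z) :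
    IntegrableOn (fun α => V (z - α)) {α | α ≤ x} F := by
  have hms : MeasurableSet {α : Fin n → ℝ | α ≤ x} := measurableSet_Iic
  refine Measure.integrableOn_of_bounded (M := V z) (measure_ne_top _ _)
    (hV.comp (measurable_const.sub measurable_id)).aestronglyMeasurable ?_
  rw [ae_restrict_iff' hms]
  have : ∀ᵐ α ∂F, 0 ≤ α := by rw [ae_iff]; exact hFpos
  filter_upwards [this] with α h1 h2
  rw [Real.norm_of_nonneg (h0 _ (sub_nonneg.mpr (le_trans h2 hzx)))]
  exact hm (sub_le_self _ h1)

lemma aux_A_mono (n : ℕ) (F : Measure (Fin n → ℝ)) [IsProbabilityMeasure F]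
    (hFpos : F {α | ¬ 0 ≤ α} = 0) (V : (Fin n → ℝ) → ℝ) (hV : Measurable V)
    (hm : Monotone V) (h0 : ∀ x, 0 ≤ x → 0 ≤ V x) :
    Monotone (fun z : Fin n → ℝ => ∫ α in {α : Fin n → ℝ | α ≤ z}, V (z - α) ∂F) := by
  intro z z' hz
  have hms : ∀ x, MeasurableSet {α : Fin n → ℝ | α ≤ x} := fun x => measurableSet_Iic
  calc ∫ α in {α : Fin n → ℝ | α ≤ z}, V (z - α) ∂F
      ≤ ∫ α in {α : Fin n → ℝ | α ≤ z}, V (z' - α) ∂F := by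
        refine setIntegral_mono_on (aux_int n F hFpos V hV hm h0 z z le_rfl)
          (aux_int n F hFpos V hV hm h0 z' z hz) (hms _) ?_
        intro α _
        exact hm (sub_le_sub_right hz α)
    _ ≤ ∫ α in {α : Fin n → ℝ | α ≤ z'}, V (z' - α) ∂F := by
        refine setIntegral_mono_set (aux_int n F hFpos V hV hm h0 z' z' le_rfl) ?_ ?_
        · exact (ae_restrict_iff' (hms _)).mpr (Eventually.of_forall fun α hα =>
            h0 _ (sub_nonneg.mpr hα))
        · exact (show {α : Fin n → ℝ | α ≤ z} ⊆ {α | α ≤ z'} from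
            fun α hα => le_trans hα hz).eventuallyLE

lemma aux_exp_int (β d : ℝ) (hβ : 0 < β) :
    ∫ t in (0:ℝ)..d, Real.exp (-β * t) = (1 - Real.exp (-β * d)) / β := by
  have hder : ∀ t ∈ Set.uIcc 0 d, HasDerivAt (fun t => -(Real.exp (-β * t)) / β)
      (Real.exp (-β * t)) t := by
    intro t _
    have h1 : HasDerivAt (fun t : ℝ => -β * t) (-β) t := by
      simpa using (hasDerivAt_id t).const_mul (-β)
    have h2 := (h1.exp.neg).div_const β
    refine h2.congr_deriv ?_
    rw [neg_div, mul_neg, neg_div, neg_neg]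
    field_simp
  rw [intervalIntegral.integral_eq_sub_of_hasDerivAt hder
    ((by fun_prop : Continuous fun t : ℝ => Real.exp (-β * t)).intervalIntegrable _ _)]
  simp
  ring

/-- one step of the dynamic programming inequality -/
lemma aux_one_step (n : ℕ) (p : Fin n → ℝ) (hp : ∀ i, 0 < p i)
    (lam β d : ℝ) (hlam : 0 < lam) (hβ : 0 < β) (hd : 0 < d)
    (F : Measure (Fin n → ℝ)) [IsProbabilityMeasure F]
    (hFpos : F {α | ¬ 0 ≤ α} = 0) (R : (Fin n → ℝ) → ℝ)
    (hRcont : ContinuousOn R {x | 0 ≤ x})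
    (V : (Fin n → ℝ) → ℝ) (hV : Measurable V)
    (hm : Monotone V) (h0 : ∀ x, 0 ≤ x → 0 ≤ V x)
    (y x : Fin n → ℝ) (hx : 0 ≤ x) (hxy : x ≤ y) (J S : ℝ)
    (hJ : J ≤ ∫ α in {α : Fin n → ℝ | α ≤ x}, V (x - α) ∂F)
    (hS : ∀ t ∈ Set.Icc 0 d, R (y + t • p) ≤ S)
    (hsup : Real.exp (-β * d) * V (y + d • p) +
        (∫ t in (0:ℝ)..d, lam * Real.exp (-β * t) *
          ∫ α in {α : Fin n → ℝ | α ≤ y + t • p}, V (y + t • p - α) ∂F) -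
        (∫ t in (0:ℝ)..d, Real.exp (-β * t) * R (y + t • p)) ≤ V y) :
    Real.exp (-β * d) * (V (y + d • p) - (lam * J - S) / β) ≤ V y - (lam * J - S) / β := by
  have hA := aux_A_mono n F hFpos V hV hm h0
  have hpath : Monotone (fun t : ℝ => y + t • p) := by
    intro s t hst i
    simp only [Pi.add_apply, Pi.smul_apply, smul_eq_mul]
    have := mul_le_mul_of_nonneg_right hst (hp i).le
    linarith
  have hyt : ∀ t : ℝ, 0 ≤ t → y ≤ y + t • p := by
    intro t ht
    simpa using hpath ht
  have hce : Continuous fun t : ℝ => Real.exp (-β * t) := by fun_prop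
  have i1 : IntervalIntegrable (fun t : ℝ => lam * Real.exp (-β * t) *
      ∫ α in {α : Fin n → ℝ | α ≤ y + t • p}, V (y + t • p - α) ∂F) volume 0 d := by
    refine IntervalIntegrable.continuousOn_mul (g := fun t : ℝ => lam * Real.exp (-β * t)) ?_ ?_
    · exact (hA.comp hpath).intervalIntegrable
    · exact (continuous_const.mul hce).continuousOn
  have i2 : IntervalIntegrable (fun t : ℝ => Real.exp (-β * t) * R (y + t • p)) volume 0 d := by
    apply ContinuousOn.intervalIntegrable
    refine hce.continuousOn.mul (hRcont.comp (by fun_prop) ?_)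
    intro t ht
    rw [Set.uIcc_of_le hd.le] at ht
    exact le_trans (le_trans hx hxy) (hyt t ht.1)
  have b1 : ∫ t in (0:ℝ)..d, (lam * J) * Real.exp (-β * t) ≤
      ∫ t in (0:ℝ)..d, lam * Real.exp (-β * t) *
      ∫ α in {α : Fin n → ℝ | α ≤ y + t • p}, V (y + t • p - α) ∂F := by
    apply intervalIntegral.integral_mono_on hd.le
      ((continuous_const.mul hce).intervalIntegrable _ _) i1
    intro t ht
    have h1 : J ≤ ∫ α in {α : Fin n → ℝ | α ≤ y + t • p}, V (y + t • p - α) ∂F :=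
      hJ.trans (hA (hxy.trans (hyt t ht.1)))
    have h2 : 0 ≤ lam * Real.exp (-β * t) := by positivity
    have := mul_le_mul_of_nonneg_left h1 h2
    simp only [Pi.mul_apply]
    linarith
  have b2 : ∫ t in (0:ℝ)..d, Real.exp (-β * t) * R (y + t • p) ≤
      ∫ t in (0:ℝ)..d, S * Real.exp (-β * t) := by
    apply intervalIntegral.integral_mono_on hd.le i2
      ((continuous_const.mul hce).intervalIntegrable _ _)
    intro t ht
    have := mul_le_mul_of_nonneg_left (hS t ht) (Real.exp_pos (-β * t)).le
    simp only [Pi.mul_apply]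
    linarith
  rw [intervalIntegral.integral_const_mul, aux_exp_int β d hβ] at b1 b2
  have e : (lam * J) * ((1 - Real.exp (-β * d)) / β) - S * ((1 - Real.exp (-β * d)) / β)
      = (lam * J - S) / β - Real.exp (-β * d) * ((lam * J - S) / β) := by
    field_simp
  rw [mul_sub]
  linarith

lemma aux_deriv_le (G : ℝ → ℝ) (G' : ℝ) (hG : HasDerivAt G G' 0) (s : ℕ → ℝ)
    (hs : ∀ k, 0 < s k) (hs0 : Tendsto s atTop (nhds 0))
    (hle : ∀ᶠ k in atTop, G (s k) ≤ G 0) : G' ≤ 0 := by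
  have h1 : Tendsto s atTop (nhdsWithin 0 {0}ᶜ) :=
    tendsto_nhdsWithin_iff.mpr ⟨hs0, Eventually.of_forall fun k => (hs k).ne'⟩
  have h2 := (hasDerivAt_iff_tendsto_slope.mp hG).comp h1
  refine le_of_tendsto h2 ?_
  filter_upwards [hle] with k hk
  simp only [Function.comp, slope_def_field, sub_zero]
  exact div_nonpos_of_nonpos_of_nonneg (by linarith) (hs k).le

/-- the limit `V̄` of the embedded-grid value functions is a viscosity
supersolution of the HJB equation at every interior point of `ℝ₊ⁿ`. -/
theorem stmt11 (n : ℕ) (hn : 1 ≤ n) (p a : Fin n → ℝ)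
    (hp : ∀ i, 0 < p i) (ha : ∀ i, 0 < a i)
    (lam c δ : ℝ) (hlam : 0 < lam) (hc : 0 < c) (hδ : 0 < δ)
    (F : Measure (Fin n → ℝ)) [IsProbabilityMeasure F]
    (hFpos : F {α | ¬ 0 ≤ α} = 0) (hF0 : F {0} = 0)
    (hFmom : Integrable (fun α => ‖α‖) F)
    (υ : (Fin n → ℝ) → (Fin n → ℝ) → ℝ) (hυmeas : Measurable (Function.uncurry υ))
    (hυint : Integrable (fun α => |υ 0 α|) F)
    (hRcont : ContinuousOn (Rpen n lam F υ) {x | 0 ≤ x})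
    (f : (Fin n → ℝ) → ℝ)
    (hf : Continuous f ∨ (Monotone f ∧ ∀ x, ContinuousWithinAt f {y | x ≤ y} x))
    (v : ℕ → (Fin n → ℕ) → ℝ) (hv0 : ∀ k m, 0 ≤ v k m)
    (hv1 : ∀ (k : ℕ) (m : Fin n → ℕ) (i : Fin n),
      a i * p i * (δ / 2 ^ k) ≤ v k (m + Pi.single i 1) - v k m)
    (hv2 : ∀ (k : ℕ) (m : Fin n → ℕ),
      v k (m + 1) - v k m ≤ v k m * (Real.exp ((c + lam) * (δ / 2 ^ k)) - 1))
    (hmono : ∀ x : Fin n → ℝ, 0 ≤ x → ∀ k,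
      Vext n p a (δ / 2 ^ k) (v k) x ≤ Vext n p a (δ / 2 ^ (k + 1)) (v (k + 1)) x)
    (Vbar : (Fin n → ℝ) → ℝ)
    (hlim : ∀ x : Fin n → ℝ, 0 ≤ x →
      Tendsto (fun k => Vext n p a (δ / 2 ^ k) (v k) x) atTop (nhds (Vbar x)))
    (hobst : ∀ (k : ℕ) (m : Fin n → ℕ), f (gdel n p (δ / 2 ^ k) m) ≤ v k m)
    (hsuper : ∀ (k : ℕ) (m : Fin n → ℕ),
      Real.exp (-(c + lam) * (δ / 2 ^ k)) *
          Vext n p a (δ / 2 ^ k) (v k) (gdel n p (δ / 2 ^ k) m + (δ / 2 ^ k) • p) +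
        (∫ t in (0:ℝ)..(δ / 2 ^ k), lam * Real.exp (-(c + lam) * t) *
          ∫ α in {α : Fin n → ℝ | α ≤ gdel n p (δ / 2 ^ k) m + t • p},
            Vext n p a (δ / 2 ^ k) (v k) (gdel n p (δ / 2 ^ k) m + t • p - α) ∂F) -
        (∫ t in (0:ℝ)..(δ / 2 ^ k), Real.exp (-(c + lam) * t) *
          Rpen n lam F υ (gdel n p (δ / 2 ^ k) m + t • p)) ≤
      Vext n p a (δ / 2 ^ k) (v k) (gdel n p (δ / 2 ^ k) m)) :
    ∀ x : Fin n → ℝ, (∀ i, 0 < x i) →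
      ∀ φ : (Fin n → ℝ) → ℝ, ContDiff ℝ 1 φ → φ x = Vbar x →
        (∀ y : Fin n → ℝ, 0 ≤ y → Vbar x - φ x ≤ Vbar y - φ y) →
        ((∀ i, a i - fderiv ℝ φ x (Pi.single i 1) ≤ 0) ∧
          Lop n p lam c F υ φ x ≤ 0 ∧ f x - φ x ≤ 0) := by
  intro x hxpos φ hφ hφx hmin
  have hx : 0 ≤ x := fun i => (hxpos i).le
  have hdk : ∀ k : ℕ, 0 < δ / 2 ^ k := fun k => by positivity
  have hdk0 : Tendsto (fun k : ℕ => δ / 2 ^ k) atTop (nhds 0) := by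
    have := (tendsto_pow_atTop_nhds_zero_of_lt_one (r := (1/2 : ℝ)) (by norm_num)
      (by norm_num)).const_mul δ
    simp only [mul_zero] at this
    refine this.congr fun k => ?_
    rw [div_pow, one_pow]; ring
  set V : ℕ → (Fin n → ℝ) → ℝ := fun k => Vext n p a (δ / 2 ^ k) (v k) with hVdef
  have hVmono : ∀ k, Monotone (V k) := fun k =>
    aux_Vext_mono n p a _ hp (hdk k) ha (v k) (hv1 k)
  have hVmeas : ∀ k, Measurable (V k) := fun k => aux_Vext_meas n p a _ (v k)
  have hVle : ∀ k y, 0 ≤ y → v k (rho n p (δ / 2 ^ k) y) ≤ V k y := fun k y hy =>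
    aux_le_Vext n p a _ hp (hdk k) ha (v k) y hy
  have hV0 : ∀ k y, 0 ≤ y → 0 ≤ V k y := fun k y hy => (hv0 _ _).trans (hVle k y hy)
  have hVk : ∀ y, 0 ≤ y → Monotone (fun k => V k y) := fun y hy =>
    monotone_nat_of_le_succ (hmono y hy)
  have hVbar : ∀ k y, 0 ≤ y → V k y ≤ Vbar y := fun k y hy =>
    (hVk y hy).ge_of_tendsto (hlim y hy) k
  have hmin' : ∀ y, 0 ≤ y → φ y ≤ Vbar y := by
    intro y hy
    have := hmin y hy
    linarith
  have hdiff : HasFDerivAt φ (fderiv ℝ φ x) x :=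
    (hφ.differentiable (by norm_num)).differentiableAt.hasFDerivAt
  set β := c + lam with hβdef
  have hβ : 0 < β := by positivity
  -- the upper grid neighbour of x
  set m : ℕ → Fin n → ℕ := fun k => rho n p (δ / 2 ^ k) x + 1 with hmdef
  have hxm : ∀ k, x ≤ gdel n p (δ / 2 ^ k) (m k) := fun k => aux_lt_proj n p _ hp (hdk k) x
  have hvm : ∀ k, v k (m k) ≤ Real.exp (β * (δ / 2 ^ k)) * V k x := by
    intro k
    have h1 := hv2 k (rho n p (δ / 2 ^ k) x)
    have h2 := mul_le_mul_of_nonneg_left (hVle k x hx) (Real.exp_pos (β * (δ / 2 ^ k))).le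
    simp only [hmdef]
    linarith
  have hlimR : Tendsto (fun k => Real.exp (β * (δ / 2 ^ k)) * V k x) atTop (nhds (Vbar x)) := by
    have h1 : Tendsto (fun k : ℕ => Real.exp (β * (δ / 2 ^ k))) atTop (nhds 1) := by
      have := (Real.continuous_exp.tendsto (β * 0)).comp (hdk0.const_mul β)
      simpa [Function.comp_def] using this
    simpa using h1.mul (hlim x hx)
  -- grid convergence
  have hprojlim : Tendsto (fun k => proj n p (δ / 2 ^ k) x) atTop (nhds x) := by
    rw [tendsto_pi_nhds]
    intro i
    have hl : Tendsto (fun k : ℕ => x i - (δ / 2 ^ k) * p i) atTop (nhds (x i)) := by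
      simpa using (tendsto_const_nhds (x := x i)).sub (hdk0.mul_const (p i))
    refine tendsto_of_tendsto_of_tendsto_of_le_of_le hl tendsto_const_nhds ?_ ?_
    · intro k
      have h1 := hxm k i
      simp only [hmdef, aux_gdel_succ] at h1
      simp only [Pi.add_apply, Pi.smul_apply, smul_eq_mul] at h1
      simp only [proj]
      linarith
    · intro k
      exact aux_proj_le n p _ hp (hdk k) x hx i
  refine ⟨?_, ?_, ?_⟩
  · -- gradient
    intro i
    have hlin : ∀ h : ℝ, 0 ≤ h → h ≤ x i →
        φ (x - h • Pi.single i 1) ≤ φ x - a i * h := by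
      intro h hh hhx
      have hle : x - h • (Pi.single i 1 : Fin n → ℝ) ≤ x := by
        intro j
        by_cases hj : j = i
        · subst hj; simpa using hh
        · simp [hj]
      have hnn : 0 ≤ x - h • (Pi.single i 1 : Fin n → ℝ) := by
        intro j
        by_cases hj : j = i
        · subst hj; simpa using hhx
        · simpa [hj] using hx j
      have hk : ∀ k, V k (x - h • (Pi.single i 1 : Fin n → ℝ)) + a i * h ≤ V k x := by
        intro k
        have h1 := aux_Vext_lin n p a _ hp (hdk k) (v k) (hv1 k) _ _ hle
        have h2 : ∑ j, a j * (x j - (x - h • (Pi.single i 1 : Fin n → ℝ)) j) = a i * h := by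
          rw [Finset.sum_eq_single i]
          · simp
          · intro j _ hj
            simp [hj]
          · simp
        rw [h2] at h1
        exact h1
      have := le_of_tendsto_of_tendsto' ((hlim _ hnn).add_const (a i * h)) (hlim x hx) hk
      have := hmin' _ hnn
      linarith
    have hd1 : HasDerivAt (fun h : ℝ => φ (x - h • Pi.single i 1) + a i * h)
        (-(fderiv ℝ φ x (Pi.single i 1)) + a i) 0 := by
      have hpath : HasDerivAt (fun h : ℝ => x - h • (Pi.single i 1 : Fin n → ℝ))
          (-(Pi.single i 1)) 0 := by
        have := ((hasDerivAt_id (0:ℝ)).smul_const (Pi.single i 1 : Fin n → ℝ)).const_sub x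
        simpa using this
      have h1 : HasDerivAt (fun h : ℝ => φ (x - h • Pi.single i 1))
          (fderiv ℝ φ x (-(Pi.single i 1))) 0 := by
        refine HasFDerivAt.comp_hasDerivAt (l := φ) (0:ℝ) ?_ hpath
        simpa using hdiff
      rw [map_neg] at h1
      have h2 : HasDerivAt (fun h : ℝ => a i * h) (a i) 0 := by
        simpa using (hasDerivAt_id (0:ℝ)).const_mul (a i)
      exact h1.add h2
    have := aux_deriv_le _ _ hd1 (fun k : ℕ => δ / 2 ^ k) hdk hdk0 (by
      have : ∀ᶠ k : ℕ in atTop, δ / 2 ^ k < x i := hdk0.eventually_lt_const (hxpos i)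
      filter_upwards [this] with k hk
      have := hlin _ (hdk k).le hk.le
      simp only [zero_smul, sub_zero, mul_zero, add_zero]
      linarith)
    linarith
  · -- generator
    set R := Rpen n lam F υ with hRdef
    have hset : {α : Fin n → ℝ | 0 ≤ x - α} = {α | α ≤ x} := by
      ext α; simp
    have hpd : fderiv ℝ φ x p = ∑ i, p i * fderiv ℝ φ x (Pi.single i 1) := by
      conv_lhs => rw [pi_eq_sum_univ' p]
      simp [map_sum]
    have key : ∀ K : ℕ, ∀ ε > 0, fderiv ℝ φ x p - β * φ x +
        lam * (∫ α in {α : Fin n → ℝ | α ≤ x}, V K (x - α) ∂F) - (R x + ε) ≤ 0 := by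
      intro K ε hε
      set J := ∫ α in {α : Fin n → ℝ | α ≤ x}, V K (x - α) ∂F with hJ
      set S := R x + ε with hS
      set C := (lam * J - S) / β with hC
      -- local bound for R
      have hRloc : ∃ r > 0, ∀ y, 0 ≤ y → dist y x < r → R y ≤ S := by
        obtain ⟨r, hr, h⟩ := Metric.continuousWithinAt_iff.mp (hRcont x hx) ε hε
        refine ⟨r, hr, fun y hy hd => ?_⟩
        have := h hy hd
        rw [Real.dist_eq] at this
        have := (abs_lt.mp this).2
        linarith
      obtain ⟨r, hr, hRr⟩ := hRloc
      -- J is below the integral for k ≥ K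
      have hJk : ∀ k, K ≤ k → J ≤ ∫ α in {α : Fin n → ℝ | α ≤ x}, V k (x - α) ∂F := by
        intro k hk
        refine setIntegral_mono_on (aux_int n F hFpos _ (hVmeas K) (hVmono K) (hV0 K) x x le_rfl)
          (aux_int n F hFpos _ (hVmeas k) (hVmono k) (hV0 k) x x le_rfl) measurableSet_Iic ?_
        intro α hα
        exact hVk _ (sub_nonneg.mpr hα) hk
      -- for large j
      have hev : ∀ᶠ j : ℕ in atTop, 3 * (δ / 2 ^ j) * ‖p‖ < r := by
        have : Tendsto (fun j : ℕ => 3 * (δ / 2 ^ j) * ‖p‖) atTop (nhds 0) := by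
          simpa using (hdk0.const_mul 3).mul_const ‖p‖
        exact this.eventually_lt_const hr
      have hmain : ∀ᶠ j : ℕ in atTop,
          Real.exp (-β * (δ / 2 ^ j)) * (φ (x + (δ / 2 ^ j) • p) - C) ≤ φ x - C := by
        filter_upwards [hev] with j hj
        set h := δ / 2 ^ j with hh
        have hh0 : 0 < h := hdk j
        have hxh : 0 ≤ x + h • p := by
          intro i
          have := mul_pos hh0 (hp i)
          have := hxpos i
          simp only [Pi.zero_apply, Pi.add_apply, Pi.smul_apply, smul_eq_mul]
          linarith
        -- discrete iteration
        have hk : ∀ k, max K j ≤ k →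
            Real.exp (-β * h) * (V k (x + h • p) - C) ≤
              Real.exp (β * (δ / 2 ^ k)) * V k x - C := by
          intro k hk
          have hKk : K ≤ k := le_trans (le_max_left _ _) hk
          have hjk : j ≤ k := le_trans (le_max_right _ _) hk
          set d := δ / 2 ^ k with hd
          have hd0 : 0 < d := hdk k
          have hdh : d * 2 ^ (k - j) = h := by
            rw [hd, hh]
            obtain ⟨l, rfl⟩ := Nat.exists_eq_add_of_le hjk
            rw [Nat.add_sub_cancel_left, pow_add]
            field_simp
          have hdle : d ≤ h := by
            rw [← hdh]
            exact le_mul_of_one_le_right hd0.le (one_le_pow₀ (by norm_num))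
          have hgN : ∀ N : ℕ, gdel n p d (m k + (N : Fin n → ℕ)) =
              gdel n p d (m k) + ((N : ℝ) * d) • p := by
            intro N
            funext i
            simp [gdel]; ring
          have hiter : ∀ N : ℕ, N ≤ 2 ^ (k - j) →
              Real.exp (-β * (N * d)) * (v k (m k + (N : Fin n → ℕ)) - C) ≤ v k (m k) - C := by
            intro N
            induction N with
            | zero => intro _; simp
            | succ N ih =>
              intro hN
              have ih' := ih (by omega)
              have hNd : (N : ℝ) * d + d ≤ h := by
                rw [← hdh]
                have : ((N + 1 : ℕ) : ℝ) ≤ ((2 ^ (k - j) : ℕ) : ℝ) := by exact_mod_cast hN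
                push_cast at this
                nlinarith
              have hxy : x ≤ gdel n p d (m k + (N : Fin n → ℕ)) := by
                rw [hgN]
                refine (hxm k).trans ?_
                intro i
                have : 0 ≤ (N : ℝ) * d * p i := by
                  have := hp i
                  positivity
                simp only [Pi.add_apply, Pi.smul_apply, smul_eq_mul]
                linarith
              have hst := aux_one_step n p hp lam β d hlam hβ hd0 F hFpos R hRcont (V k)
                (hVmeas k) (hVmono k) (hV0 k) (gdel n p d (m k + (N : Fin n → ℕ))) x hx hxy J S
                (hJk k hKk) (by
                  intro t ht
                  have hnn : x ≤ gdel n p d (m k + (N : Fin n → ℕ)) + t • p := by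
                    refine hxy.trans ?_
                    intro i
                    have := mul_nonneg ht.1 (hp i).le
                    simp only [Pi.add_apply, Pi.smul_apply, smul_eq_mul]
                    linarith
                  refine hRr _ (hx.trans hnn) ?_
                  refine lt_of_le_of_lt ?_ hj
                  rw [dist_pi_le_iff (by positivity)]
                  intro i
                  rw [Real.dist_eq, abs_of_nonneg (sub_nonneg.mpr (hnn i)), hgN]
                  have h1 := aux_proj_le n p d hp hd0 x hx i
                  have h2 : gdel n p d (m k) i = proj n p d x i + d * p i := by
                    simp only [hmdef, aux_gdel_succ]
                    simp [proj, ← hd]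
                  have h3 : p i ≤ ‖p‖ := (le_abs_self _).trans (norm_le_pi_norm p i)
                  simp only [Pi.add_apply, Pi.smul_apply, smul_eq_mul]
                  rw [h2]
                  have h4 : d + (N * d) + t ≤ 3 * h := by
                    have := ht.2
                    linarith
                  have h5 : (d + (N * d) + t) * p i ≤ 3 * h * ‖p‖ :=
                    mul_le_mul h4 h3 (hp i).le (by positivity)
                  linarith)
                (hsuper k _)
              rw [← aux_gdel_succ] at hst
              simp only [hVdef] at hst
              rw [aux_Vext_gdel n p a _ hp hd0, aux_Vext_gdel n p a _ hp hd0] at hst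
              have e1 : m k + ((N + 1 : ℕ) : Fin n → ℕ) = m k + (N : Fin n → ℕ) + 1 := by
                rw [Nat.cast_succ]; exact (add_assoc _ _ _).symm
              have e2 : Real.exp (-β * (((N + 1 : ℕ) : ℝ) * d)) =
                  Real.exp (-β * (N * d)) * Real.exp (-β * d) := by
                rw [← Real.exp_add]; congr 1; push_cast; ring
              rw [e1, e2, mul_assoc]
              exact (mul_le_mul_of_nonneg_left hst (Real.exp_pos _).le).trans ih'
          have hfin := hiter (2 ^ (k - j)) le_rfl
          have e3 : (((2 ^ (k - j) : ℕ) : ℕ) : ℝ) * d = h := by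
            push_cast; linarith
          have e4 : V k (x + h • p) ≤ v k (m k + ((2 ^ (k - j) : ℕ) : Fin n → ℕ)) := by
            rw [← aux_Vext_gdel n p a d hp hd0 (v k), hgN, e3]
            exact hVmono k (add_le_add_left (hxm k) _)
          rw [e3] at hfin
          have e5 := mul_le_mul_of_nonneg_left (sub_le_sub_right e4 C) (Real.exp_pos (-β * h)).le
          have := hvm k
          linarith
        have hl := le_of_tendsto_of_tendsto
          (((hlim _ hxh).sub_const C).const_mul (Real.exp (-β * h)))
          (hlimR.sub_const C) ((eventually_ge_atTop (max K j)).mono hk)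
        have h6 := mul_le_mul_of_nonneg_left (sub_le_sub_right (hmin' _ hxh) C)
          (Real.exp_pos (-β * h)).le
        rw [hφx]
        linarith
      have hd1 : HasDerivAt (fun h : ℝ => Real.exp (-β * h) * (φ (x + h • p) - C))
          (-β * (φ x - C) + fderiv ℝ φ x p) 0 := by
        have hpath : HasDerivAt (fun h : ℝ => x + h • p) p 0 := by
          simpa using ((hasDerivAt_id (0:ℝ)).smul_const p).const_add x
        have h1 : HasDerivAt (fun h : ℝ => φ (x + h • p)) (fderiv ℝ φ x p) 0 := by
          refine HasFDerivAt.comp_hasDerivAt (l := φ) (0:ℝ) ?_ hpath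
          simpa using hdiff
        have h2 : HasDerivAt (fun t : ℝ => Real.exp (-β * t)) (-β) 0 := by
          have : HasDerivAt (fun t : ℝ => -β * t) (-β) 0 := by
            simpa using (hasDerivAt_id (0:ℝ)).const_mul (-β)
          simpa using this.exp
        refine (h2.mul (h1.sub_const C)).congr_deriv ?_
        simp
      have hfin := aux_deriv_le _ _ hd1 (fun k : ℕ => δ / 2 ^ k) hdk hdk0 (by
        filter_upwards [hmain] with j hj
        simpa using hj)
      have : β * C = lam * J - S := by rw [hC]; field_simp
      linarith
    have hae : ∀ᵐ α ∂F, 0 ≤ α := by rw [ae_iff]; exact hFpos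
    have hlimae : ∀ᵐ α ∂(F.restrict {α : Fin n → ℝ | α ≤ x}),
        Tendsto (fun K => V K (x - α)) atTop (nhds (Vbar (x - α))) := by
      refine (ae_restrict_iff' measurableSet_Iic).mpr (Eventually.of_forall fun α hα => ?_)
      exact hlim _ (sub_nonneg.mpr hα)
    have hmeasK : ∀ K, AEStronglyMeasurable (fun α => V K (x - α))
        (F.restrict {α : Fin n → ℝ | α ≤ x}) := fun K =>
      (aux_int n F hFpos _ (hVmeas K) (hVmono K) (hV0 K) x x le_rfl).aestronglyMeasurable
    have hJlim : Tendsto (fun K => ∫ α in {α : Fin n → ℝ | α ≤ x}, V K (x - α) ∂F) atTop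
        (nhds (∫ α in {α : Fin n → ℝ | α ≤ x}, Vbar (x - α) ∂F)) := by
      refine tendsto_integral_of_dominated_convergence (fun _ => Vbar x) hmeasK
        (integrable_const _) ?_ hlimae
      intro K
      refine (ae_restrict_iff' measurableSet_Iic).mpr ?_
      filter_upwards [hae] with α h1 h2
      rw [Real.norm_of_nonneg (hV0 K _ (sub_nonneg.mpr h2))]
      exact (hVmono K (sub_le_self _ h1)).trans (hVbar K x hx)
    have hVb0 : ∀ y, 0 ≤ y → 0 ≤ Vbar y := fun y hy => (hV0 0 y hy).trans (hVbar 0 y hy)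
    have hbint : IntegrableOn (fun α => Vbar (x - α)) {α : Fin n → ℝ | α ≤ x} F := by
      refine Integrable.of_bound (aestronglyMeasurable_of_tendsto_ae atTop hmeasK hlimae)
        (Vbar x) ?_
      refine (ae_restrict_iff' measurableSet_Iic).mpr ?_
      filter_upwards [hae] with α h1 h2
      rw [Real.norm_of_nonneg (hVb0 _ (sub_nonneg.mpr h2))]
      refine le_of_tendsto' (hlim _ (sub_nonneg.mpr h2)) fun K => ?_
      exact (hVmono K (sub_le_self _ h1)).trans (hVbar K x hx)
    have hcmp : ∫ α in {α : Fin n → ℝ | α ≤ x}, φ (x - α) ∂F ≤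
        ∫ α in {α : Fin n → ℝ | α ≤ x}, Vbar (x - α) ∂F := by
      by_cases hi : IntegrableOn (fun α => φ (x - α)) {α : Fin n → ℝ | α ≤ x} F
      · refine setIntegral_mono_on hi hbint measurableSet_Iic ?_
        intro α hα
        exact hmin' _ (sub_nonneg.mpr hα)
      · rw [integral_undef hi]
        exact setIntegral_nonneg measurableSet_Iic fun α hα => hVb0 _ (sub_nonneg.mpr hα)
    have key2 : ∀ ε > 0, fderiv ℝ φ x p - β * φ x +
        lam * (∫ α in {α : Fin n → ℝ | α ≤ x}, Vbar (x - α) ∂F) - (R x + ε) ≤ 0 := by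
      intro ε hε
      refine le_of_tendsto' ((((hJlim.const_mul lam).const_add _)).sub_const _)
        (fun K => key K ε hε)
    have key3 := mul_le_mul_of_nonneg_left hcmp hlam.le
    have key4 : fderiv ℝ φ x p - β * φ x +
        lam * (∫ α in {α : Fin n → ℝ | α ≤ x}, Vbar (x - α) ∂F) - R x ≤ 0 := by
      refine le_of_forall_pos_le_add fun ε hε => ?_
      have := key2 ε hε
      linarith
    simp only [Lop, Iop, hset, ← hpd, ← hβdef]
    linarith
  · -- obstacle
    rw [hφx]
    rcases hf with hf | ⟨hf, -⟩
    · have h1 : Tendsto (fun k => f (proj n p (δ / 2 ^ k) x)) atTop (nhds (f x)) :=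
        (hf.tendsto x).comp hprojlim
      have := le_of_tendsto_of_tendsto' h1 (hlim x hx) (fun k =>
        (hobst k (rho n p (δ / 2 ^ k) x)).trans (hVle k x hx))
      linarith
    · have := ge_of_tendsto' hlimR (fun k =>
        (hf (hxm k)).trans ((hobst k (m k)).trans (hvm k)))
      linarith

end
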